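/- arXiv:1912.12908 — 2 statements merged into one kernel-verified Lean document; each statement's English description precedes it below -/
import Mathlib

section
/- In any large game, every randomized strategy robust perfect equilibrium is admissible. -/
open MeasureTheory Filter Topology

section RobustPerfect

variable {I : Type*} [MeasurableSpace I] {A : Type*} [Fintype A]

/-- The societal summary of a randomized strategy profile. -/
noncomputable def socSum (lam : Measure I) (h : I → A → ℝ) : A → ℝ :=
  fun a => ∫ i, h i a ∂lam

/-- `h` is a randomized strategy profile: a measurable map into the simplex. -/
def IsProfile (lam : Measure I) (h : I → A → ℝ) : Prop :=
  Measurable h ∧ ∀ i, h i ∈ stdSimplex ℝ A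

/-- A large game: payoffs continuous on the simplex and measurable in the player. -/
def IsLargeGame (u : I → A → (A → ℝ) → ℝ) : Prop :=
  (∀ i a, ContinuousOn (u i a) (stdSimplex ℝ A)) ∧
  (∀ (a : A) (τ : A → ℝ), τ ∈ stdSimplex ℝ A → Measurable fun i => u i a τ)

/-- An atomless measure. -/
def MeasAtomless (lam : Measure I) : Prop :=
  ∀ s : Set I, MeasurableSet s → 0 < lam s →
    ∃ t : Set I, MeasurableSet t ∧ t ⊆ s ∧ 0 < lam t ∧ lam t < lam s

/-- A Borel probability measure concentrated on the simplex with full support on it. -/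
def FullSupportOnSimplex (η : Measure (A → ℝ)) : Prop :=
  IsProbabilityMeasure η ∧ η (stdSimplex ℝ A)ᶜ = 0 ∧
    ∀ U : Set (A → ℝ), IsOpen U → (U ∩ stdSimplex ℝ A).Nonempty → 0 < η U

/-- A perturbation function: a Borel measurable map from the simplex to the
full-support Borel probability measures on the simplex. -/
def IsPerturbation (φ : (A → ℝ) → Measure (A → ℝ)) : Prop :=
  (∀ τ ∈ stdSimplex ℝ A, FullSupportOnSimplex (φ τ)) ∧
  ∀ f : (A → ℝ) → ℝ, Continuous f → Measurable fun τ => ∫ x, f x ∂(φ τ)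

/-- Expected payoff of action `a` against a distribution over societal summaries. -/
noncomputable def payM (ui : A → (A → ℝ) → ℝ) (a : A) (ν : Measure (A → ℝ)) : ℝ :=
  ∫ τ, ui a τ ∂ν

/-- Randomized strategy Nash equilibrium. -/
def IsNash (lam : Measure I) (u : I → A → (A → ℝ) → ℝ) (h : I → A → ℝ) : Prop :=
  IsProfile lam h ∧
  ∀ᵐ i ∂lam, ∀ μ ∈ stdSimplex ℝ A,
    ∑ a, μ a * u i a (socSum lam h) ≤ ∑ a, h i a * u i a (socSum lam h)

/-- A weakly dominated action. -/
def WeaklyDominated (ui : A → (A → ℝ) → ℝ) (a : A) : Prop :=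
  ∃ μ ∈ stdSimplex ℝ A,
    (∀ τ ∈ stdSimplex ℝ A, ui a τ ≤ ∑ b, μ b * ui b τ) ∧
    (∃ τ ∈ stdSimplex ℝ A, ui a τ < ∑ b, μ b * ui b τ)

/-- Admissibility: almost no player puts weight on a weakly dominated action. -/
def Admissible (lam : Measure I) (u : I → A → (A → ℝ) → ℝ) (h : I → A → ℝ) : Prop :=
  ∀ᵐ i ∂lam, ∀ a : A, WeaklyDominated (u i) a → h i a = 0

/-- Weak convergence of a sequence of measures to a Dirac measure. -/
def WeakTendstoDirac (ν : ℕ → Measure (A → ℝ)) (τ : A → ℝ) : Prop :=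
  ∀ f : (A → ℝ) → ℝ, Continuous f →
    Tendsto (fun n => ∫ x, f x ∂(ν n)) atTop (nhds (f τ))

/-- Aggregate robustness. -/
def AggregateRobust (lam : Measure I) (u : I → A → (A → ℝ) → ℝ) (h : I → A → ℝ) : Prop :=
  ∀ᵐ i ∂lam, ∃ φ : ℕ → (A → ℝ) → Measure (A → ℝ),
    (∀ n, IsPerturbation (φ n)) ∧
    (∀ τ ∈ stdSimplex ℝ A, WeakTendstoDirac (fun n => φ n τ) τ) ∧
    ∀ n, ∀ μ ∈ stdSimplex ℝ A,
      ∑ a, μ a * payM (u i) a (φ n (socSum lam h)) ≤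
        ∑ a, h i a * payM (u i) a (φ n (socSum lam h))

/-- `ε`-robust perfect equilibrium with perturbed player space `Iε` and
perturbation function `φ`. -/
def IsEpsRPE (lam : Measure I) (u : I → A → (A → ℝ) → ℝ) (ε : ℝ)
    (h : I → A → ℝ) (Iε : Set I) (φ : (A → ℝ) → Measure (A → ℝ)) : Prop :=
  IsProfile lam h ∧
  (∀ᵐ i ∂lam, ∀ a : A, 0 < h i a) ∧
  MeasurableSet Iε ∧ ENNReal.ofReal (1 - ε) < lam Iε ∧
  IsPerturbation φ ∧
  (∀ τ ∈ stdSimplex ℝ A, ENNReal.ofReal (1 - ε) ≤ φ τ {τ}) ∧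
  ∀ i ∈ Iε, ∀ am al : A,
    payM (u i) am (φ (socSum lam h)) < payM (u i) al (φ (socSum lam h)) →
      h i am ≤ ε

/-- Robust perfect equilibrium. -/
def IsRPE (lam : Measure I) (u : I → A → (A → ℝ) → ℝ) (h : I → A → ℝ) : Prop :=
  IsProfile lam h ∧
  ∃ (ε : ℕ → ℝ) (hs : ℕ → I → A → ℝ) (Is : ℕ → Set I)
      (φs : ℕ → (A → ℝ) → Measure (A → ℝ)),
    (∀ n, 0 < ε n) ∧ Tendsto ε atTop (nhds 0) ∧
    (∀ n, IsEpsRPE lam u (ε n) (hs n) (Is n) (φs n)) ∧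
    (∀ᵐ i ∂lam, ∃ nk : ℕ → ℕ, StrictMono nk ∧ (∀ k, i ∈ Is (nk k)) ∧
      Tendsto (fun k => hs (nk k) i) atTop (nhds (h i))) ∧
    Tendsto (fun n => socSum lam (hs n)) atTop (nhds (socSum lam h))

/-- The Dirac randomized strategy profile induced by a pure strategy profile. -/
def diracProfile [DecidableEq A] (f : I → A) : I → A → ℝ :=
  fun i a => if a = f i then 1 else 0

end RobustPerfect

/-- The societal summary of a profile lies in the simplex. -/
theorem socSum_mem_stdSimplex {I : Type*} [MeasurableSpace I] {A : Type*} [Fintype A]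
    (lam : Measure I) [IsProbabilityMeasure lam] {h : I → A → ℝ} (hh : IsProfile lam h) :
    socSum lam h ∈ stdSimplex ℝ A := by
  obtain ⟨hmeas, hmem⟩ := hh
  have hint : ∀ a, Integrable (fun i => h i a) lam := fun a =>
    Integrable.of_bound ((measurable_pi_apply a).comp hmeas).aestronglyMeasurable 1
      (Eventually.of_forall fun i => by
        rw [Real.norm_eq_abs, abs_of_nonneg ((hmem i).1 a), ← (hmem i).2]
        exact Finset.single_le_sum (fun b _ => (hmem i).1 b) (Finset.mem_univ a))
  refine ⟨fun a => integral_nonneg fun i => (hmem i).1 a, ?_⟩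
  simp only [socSum]
  rw [← integral_finsetSum _ fun a _ => hint a]
  simp [fun i => (hmem i).2]

/-- A function continuous on the simplex is integrable against any finite measure concentrated
on the simplex. -/
theorem integrable_of_continuousOn_stdSimplex {A : Type*} [Fintype A] {η : Measure (A → ℝ)}
    [IsFiniteMeasure η] (hη : η (stdSimplex ℝ A)ᶜ = 0) {f : (A → ℝ) → ℝ}
    (hf : ContinuousOn f (stdSimplex ℝ A)) : Integrable f η := by
  have hint := hf.integrableOn_compact (μ := η) (isCompact_stdSimplex ℝ A)
  have hmem : ∀ᵐ x ∂η, x ∈ stdSimplex ℝ A := mem_ae_iff.2 hη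
  rwa [IntegrableOn, Measure.restrict_eq_self_of_ae_mem hmem] at hint

/-- A function that is continuous and nonnegative on the simplex, and positive at some point of
it, has positive integral against any measure with full support on the simplex. -/
theorem FullSupportOnSimplex.integral_pos {A : Type*} [Fintype A] {η : Measure (A → ℝ)}
    (hη : FullSupportOnSimplex η) {f : (A → ℝ) → ℝ} (hf : ContinuousOn f (stdSimplex ℝ A))
    (hnonneg : ∀ τ ∈ stdSimplex ℝ A, 0 ≤ f τ) {τ : A → ℝ} (hτ : τ ∈ stdSimplex ℝ A)
    (hpos : 0 < f τ) : 0 < ∫ x, f x ∂η := by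
  obtain ⟨_, hnull, hopen⟩ := hη
  have hmem : ∀ᵐ x ∂η, x ∈ stdSimplex ℝ A := mem_ae_iff.2 hnull
  have hae : 0 ≤ᵐ[η] f := hmem.mono hnonneg
  rw [integral_pos_iff_support_of_nonneg_ae hae (integrable_of_continuousOn_stdSimplex hnull hf)]
  obtain ⟨U, hU, hUeq⟩ := continuousOn_iff'.1 hf (Set.Ioi 0) isOpen_Ioi
  refine (hopen U hU ⟨τ, (hUeq ▸ ⟨hpos, hτ⟩ : τ ∈ U ∩ stdSimplex ℝ A)⟩).trans_le
    (measure_mono_ae ?_)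
  filter_upwards [hmem] with x hx hxU
  exact ne_of_gt (hUeq ▸ ⟨hxU, hx⟩ : x ∈ f ⁻¹' Set.Ioi 0 ∩ stdSimplex ℝ A).1

/-- Against a measure with full support on the simplex, a weakly dominated action does strictly
worse than some other action. -/
theorem WeaklyDominated.exists_payM_lt {A : Type*} [Fintype A] {ui : A → (A → ℝ) → ℝ} {a : A}
    (ha : WeaklyDominated ui a) (hui : ∀ b, ContinuousOn (ui b) (stdSimplex ℝ A))
    {η : Measure (A → ℝ)} (hη : FullSupportOnSimplex η) :
    ∃ b, payM ui a η < payM ui b η := by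
  obtain ⟨μ, hμ, hle, τ, hτ, hlt⟩ := ha
  have hprob := hη.1
  have hint : ∀ b, Integrable (ui b) η := fun b =>
    integrable_of_continuousOn_stdSimplex hη.2.1 (hui b)
  have hcont : ContinuousOn (fun x => ∑ b, μ b * ui b x - ui a x) (stdSimplex ℝ A) :=
    (continuousOn_finsetSum _ fun b _ => continuousOn_const.mul (hui b)).sub (hui a)
  have hpos := hη.integral_pos hcont (fun x hx => sub_nonneg.2 (hle x hx)) hτ (sub_pos.2 hlt)
  rw [integral_sub (integrable_finsetSum _ fun b _ => (hint b).const_mul _) (hint a),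
    integral_finsetSum _ fun b _ => (hint b).const_mul _] at hpos
  simp only [integral_const_mul] at hpos
  by_contra! hcon
  have hsum : ∑ b, μ b * payM ui b η ≤ ∑ b, μ b * payM ui a η :=
    Finset.sum_le_sum fun b _ => mul_le_mul_of_nonneg_left (hcon b) (hμ.1 b)
  rw [← Finset.sum_mul, hμ.2, one_mul] at hsum
  simp only [payM] at hsum
  linarith

/-- In any large game, every randomized strategy robust perfect
equilibrium is admissible. -/
theorem statement3 {I : Type*} [MeasurableSpace I] {A : Type*} [Fintype A] [Nonempty A]
    (lam : Measure I) [IsProbabilityMeasure lam] (hatomless : MeasAtomless lam)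
    (u : I → A → (A → ℝ) → ℝ) (hu : IsLargeGame u)
    (h : I → A → ℝ) (hrpe : IsRPE lam u h) :
    Admissible lam u h := by
  obtain ⟨hprof, ε, hs, Is, φs, -, hε, heps, hsub, -⟩ := hrpe
  filter_upwards [hsub] with i hi a ha
  obtain ⟨nk, hnk, hmem, hlim⟩ := hi
  refine le_antisymm ?_ ((hprof.2 i).1 a)
  refine le_of_tendsto_of_tendsto' (tendsto_pi_nhds.1 hlim a) (hε.comp hnk.tendsto_atTop)
    fun k => ?_
  obtain ⟨hp, -, -, -, hφ, -, hbest⟩ := heps (nk k)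
  obtain ⟨b, hb⟩ := ha.exists_payM_lt (hu.1 i) (hφ.1 _ (socSum_mem_stdSimplex lam hp))
  exact hbest i (hmem k) a b hb
end

section
/- In any large game, every randomized strategy robust perfect equilibrium is aggregate robust. -/
open MeasureTheory Filter Topology

/-- The societal summary of a randomized strategy profile lies in the simplex. -/
lemma IsProfile.socSum_mem {I : Type*} [MeasurableSpace I] {A : Type*} [Fintype A]
    {lam : Measure I} [IsProbabilityMeasure lam] {h : I → A → ℝ} (hh : IsProfile lam h) :
    socSum lam h ∈ stdSimplex ℝ A := by
  refine ⟨fun a => integral_nonneg fun i => (hh.2 i).1 a, ?_⟩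
  have hint : ∀ a, Integrable (fun i => h i a) lam := fun a => by
    refine Integrable.of_bound ((measurable_pi_iff.1 hh.1) a).aestronglyMeasurable 1
      (.of_forall fun i => ?_)
    rw [Real.norm_of_nonneg ((hh.2 i).1 a)]
    exact (Finset.single_le_sum (fun b _ => (hh.2 i).1 b) (Finset.mem_univ a)).trans_eq (hh.2 i).2
  simp only [socSum]
  rw [← integral_finsetSum _ fun a _ => hint a]
  simp [(hh.2 _).2]

/-- If a probability measure on a set `S` gives mass at least `1 - ε` to a point `x` of `S`, then
the integral of a function bounded by `M` on `S` is within `2 * M * ε` of its value at `x`. -/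
lemma abs_integral_sub_le_of_le_measure_singleton {X : Type*} [MeasurableSpace X]
    [MeasurableSingletonClass X] {ν : Measure X} [IsProbabilityMeasure ν] {S : Set X}
    (hS : ν Sᶜ = 0) {x : X} (hx : x ∈ S) {ε : ℝ} (hν : ENNReal.ofReal (1 - ε) ≤ ν {x})
    {f : X → ℝ} (hf : Measurable f) {M : ℝ} (hM : ∀ y ∈ S, |f y| ≤ M) :
    |∫ y, f y ∂ν - f x| ≤ 2 * M * ε := by
  have hM0 : 0 ≤ M := (abs_nonneg _).trans (hM x hx)
  have hae : ∀ᵐ y ∂ν, y ∈ S := mem_ae_iff.2 hS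
  have hfi : Integrable f ν :=
    Integrable.of_bound hf.aestronglyMeasurable M (hae.mono fun y hy => hM y hy)
  have hcompl : ν.real {x}ᶜ ≤ ε := by
    rw [probReal_compl_eq_one_sub (measurableSet_singleton x)]
    have : 1 - ε ≤ ν.real {x} := (ENNReal.ofReal_le_iff_le_toReal (measure_ne_top _ _)).1 hν
    linarith
  calc |∫ y, f y ∂ν - f x| = |∫ y, (f y - f x) ∂ν| := by
        rw [integral_sub hfi (integrable_const _)]; simp
    _ ≤ ∫ y, |f y - f x| ∂ν := abs_integral_le_integral_abs
    _ ≤ ∫ y, ({x}ᶜ : Set X).indicator (fun _ => 2 * M) y ∂ν := by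
        refine integral_mono_ae (hfi.sub (integrable_const _)).abs
          ((integrable_const _).indicator (measurableSet_singleton x).compl)
          (hae.mono fun y hy => ?_)
        by_cases hyx : y = x
        · simp [hyx]
        · have hmem : y ∈ ({x}ᶜ : Set X) := hyx
          simp only [Set.indicator_of_mem hmem]
          have := abs_sub (f y) (f x)
          linarith [hM y hy, hM x hx]
    _ = 2 * M * ν.real {x}ᶜ := by
        rw [integral_indicator_const _ (measurableSet_singleton x).compl, smul_eq_mul, mul_comm]
    _ ≤ 2 * M * ε := by gcongr

/-- Measures on the simplex that concentrate on points converging to `τ` converge weakly to the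
Dirac measure at `τ`. -/
lemma weakTendstoDirac_of_le_measure_singleton {A : Type*} [Fintype A]
    {ν : ℕ → Measure (A → ℝ)} (hν : ∀ n, FullSupportOnSimplex (ν n)) {x : ℕ → A → ℝ}
    (hx : ∀ n, x n ∈ stdSimplex ℝ A) {ε : ℕ → ℝ}
    (hmass : ∀ n, ENNReal.ofReal (1 - ε n) ≤ ν n {x n}) (hε : Tendsto ε atTop (𝓝 0))
    {τ : A → ℝ} (hτ : Tendsto x atTop (𝓝 τ)) :
    WeakTendstoDirac ν τ := by
  intro f hf
  obtain ⟨M, hM⟩ := (isCompact_stdSimplex ℝ A).exists_bound_of_continuousOn hf.continuousOn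
  have hdiff : Tendsto (fun n => ∫ y, f y ∂(ν n) - f (x n)) atTop (𝓝 0) := by
    refine squeeze_zero_norm (fun n => ?_) (by simpa using hε.const_mul (2 * M))
    have := (hν n).1
    exact abs_integral_sub_le_of_le_measure_singleton (hν n).2.1 (hx n) (hmass n) hf.measurable hM
  simpa using hdiff.add ((hf.tendsto τ).comp hτ)

/-- Redirecting a perturbation function at one point to one of its other values on the simplex
gives a perturbation function. -/
lemma IsPerturbation.update {A : Type*} [Fintype A] [DecidableEq (A → ℝ)]
    {φ : (A → ℝ) → Measure (A → ℝ)}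
    (hφ : IsPerturbation φ) (τ : A → ℝ) {σ : A → ℝ} (hσ : σ ∈ stdSimplex ℝ A) :
    IsPerturbation (Function.update φ τ (φ σ)) := by
  refine ⟨fun ρ hρ => ?_, fun f hf => ?_⟩
  · by_cases hρτ : ρ = τ
    · subst hρτ
      simpa using hφ.1 σ hσ
    · simpa [hρτ] using hφ.1 ρ hρ
  · refine (hφ.2 f hf).measurable_of_countable_ne
      ((Set.countable_singleton τ).mono fun ρ hρ => by_contra fun hne => hρ ?_)
    rw [Function.update_of_ne hne]

/-- A mixed action supported on maximizers of `p` maximizes the expectation of `p`. -/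
lemma sum_mul_le_sum_mul_of_pos_imp_max {A : Type*} [Fintype A] {p ν μ : A → ℝ}
    (hν : ν ∈ stdSimplex ℝ A) (hμ : μ ∈ stdSimplex ℝ A) (hmax : ∀ a, 0 < ν a → ∀ b, p b ≤ p a) :
    ∑ a, μ a * p a ≤ ∑ a, ν a * p a := by
  calc ∑ a, μ a * p a = ∑ b, ν b * ∑ a, μ a * p a := by rw [← Finset.sum_mul, hν.2, one_mul]
    _ ≤ ∑ b, ν b * p b := Finset.sum_le_sum fun b _ => by
        rcases (hν.1 b).eq_or_lt with hb | hb
        · simp [← hb]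
        · refine mul_le_mul_of_nonneg_left ?_ hb.le
          calc ∑ a, μ a * p a ≤ ∑ a, μ a * p b :=
                Finset.sum_le_sum fun a _ => mul_le_mul_of_nonneg_left (hmax b hb a) (hμ.1 a)
            _ = p b := by rw [← Finset.sum_mul, hμ.2, one_mul]

/-- In any large game, every randomized strategy robust perfect
equilibrium is aggregate robust. -/
theorem statement4 {I : Type*} [MeasurableSpace I] {A : Type*} [Fintype A] [Nonempty A]
    (lam : Measure I) [IsProbabilityMeasure lam] (hatomless : MeasAtomless lam)
    (u : I → A → (A → ℝ) → ℝ) (hu : IsLargeGame u)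
    (h : I → A → ℝ) (hrpe : IsRPE lam u h) :
    AggregateRobust lam u h := by
  classical
  obtain ⟨hprof, ε, hs, Is, φs, -, hε, heq, hsub, hsum⟩ := hrpe
  filter_upwards [hsub] with i hi
  obtain ⟨nk, hmono, hIs, hlim⟩ := hi
  have hev : ∀ᶠ k in atTop, ∀ a, 0 < h i a → ε (nk k) < hs (nk k) i a := by
    refine eventually_all.2 fun a => ?_
    by_cases ha : 0 < h i a
    · filter_upwards [(hε.comp hmono.tendsto_atTop).eventually_lt
        ((tendsto_pi_nhds.1 hlim) a) ha] with k hk _ using hk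
    · exact .of_forall fun k hpos => absurd hpos ha
  obtain ⟨K, hK⟩ := eventually_atTop.1 hev
  let m : ℕ → ℕ := fun n => nk (n + K)
  have hm : Tendsto m atTop atTop := hmono.tendsto_atTop.comp (tendsto_add_atTop_nat K)
  let σ : ℕ → A → ℝ := fun n => socSum lam (hs (m n))
  have hσ : ∀ n, σ n ∈ stdSimplex ℝ A := fun n => (heq (m n)).1.socSum_mem
  have hpert : ∀ n, IsPerturbation (φs (m n)) := fun n => (heq (m n)).2.2.2.2.1
  have hmass : ∀ n, ∀ τ ∈ stdSimplex ℝ A, ENNReal.ofReal (1 - ε (m n)) ≤ φs (m n) τ {τ} :=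
    fun n => (heq (m n)).2.2.2.2.2.1
  refine ⟨fun n => Function.update (φs (m n)) (socSum lam h) (φs (m n) (σ n)),
    fun n => (hpert n).update _ (hσ n), fun τ hτ => ?_, fun n μ hμ => ?_⟩
  · by_cases hτh : τ = socSum lam h
    · subst hτh
      simpa using weakTendstoDirac_of_le_measure_singleton (fun n => (hpert n).1 _ (hσ n)) hσ
        (fun n => hmass n _ (hσ n)) (hε.comp hm) (hsum.comp hm)
    · simpa [hτh] using weakTendstoDirac_of_le_measure_singleton (fun n => (hpert n).1 τ hτ)
        (fun _ => hτ) (fun n => hmass n τ hτ) (hε.comp hm) tendsto_const_nhds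
  · simp only [Function.update_self]
    refine sum_mul_le_sum_mul_of_pos_imp_max (hprof.2 i) hμ fun a ha b => ?_
    by_contra! hlt
    exact ((heq (m n)).2.2.2.2.2.2 i (hIs _) a b hlt).not_gt (hK _ (Nat.le_add_left K n) a ha)
end
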